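/- Let C ⊆ ℝ^d be convex with constrained least-squares solution x_LS, and run the iterative Hessian sketch with sketch matrices S¹,…,S^N. Let ρ ∈ (0, 1/2). If for every t = 0,…,N−1 one has A(x_LS − x^t) ≠ 0, Z₁^{t+1} ≥ 1 − ρ, and Z₂^{t+1} ≤ ρ/2, then the final iterate satisfies ‖x^N − x_LS‖_A ≤ ρ^N · ‖x_LS‖_A. -/

import Mathlib

open MeasureTheory Matrix Finset

/-- Squared Euclidean norm of a vector. -/
noncomputable def sqNorm {k : ℕ} (v : Fin k → ℝ) : ℝ := ∑ i, (v i) ^ 2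

/-- Euclidean (ℓ₂) norm of a vector. -/
noncomputable def l2norm {k : ℕ} (v : Fin k → ℝ) : ℝ := Real.sqrt (sqNorm v)

/-- Prediction semi-norm ‖v‖_A = (1/√n)‖A v‖₂. -/
noncomputable def predNorm {n d : ℕ} (A : Matrix (Fin n) (Fin d) ℝ) (v : Fin d → ℝ) : ℝ :=
  l2norm (A.mulVec v) / Real.sqrt n

/-- Transformed tangent cone K_LS = {t · A(x − x_LS) : t ≥ 0, x ∈ C}. -/
def Kcone {n d : ℕ} (A : Matrix (Fin n) (Fin d) ℝ) (C : Set (Fin d → ℝ))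
    (xLS : Fin d → ℝ) : Set (Fin n → ℝ) :=
  {v | ∃ t : ℝ, 0 ≤ t ∧ ∃ x ∈ C, v = t • A.mulVec (x - xLS)}

/-- Z₁(S) = inf over unit-norm vectors of the cone of (1/m)‖S v‖₂². -/
noncomputable def Z1 {n m : ℕ} (S : Matrix (Fin m) (Fin n) ℝ) (K : Set (Fin n → ℝ)) : ℝ :=
  sInf ((fun v => (1 / (m : ℝ)) * sqNorm (S.mulVec v)) '' {v ∈ K | l2norm v = 1})

/-- Z₂(S) = sup over unit-norm vectors of the cone of |⟨u, (SᵀS/m − I) v⟩|. -/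
noncomputable def Z2 {n m : ℕ} (S : Matrix (Fin m) (Fin n) ℝ) (K : Set (Fin n → ℝ))
    (u : Fin n → ℝ) : ℝ :=
  sSup ((fun v => |u ⬝ᵥ (((1 / (m : ℝ)) • (Sᵀ * S) - 1).mulVec v)|) '' {v ∈ K | l2norm v = 1})

lemma sqNorm_eq {k : ℕ} (v : Fin k → ℝ) : sqNorm v = v ⬝ᵥ v := by
  simp [sqNorm, dotProduct, sq]

lemma sqNorm_nonneg' {k : ℕ} (v : Fin k → ℝ) : 0 ≤ sqNorm v :=
  Finset.sum_nonneg fun i _ => sq_nonneg _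

lemma l2norm_sq {k : ℕ} (v : Fin k → ℝ) : l2norm v ^ 2 = sqNorm v :=
  Real.sq_sqrt (sqNorm_nonneg' v)

lemma l2norm_nonneg' {k : ℕ} (v : Fin k → ℝ) : 0 ≤ l2norm v := Real.sqrt_nonneg _

lemma l2norm_neg' {k : ℕ} (v : Fin k → ℝ) : l2norm (-v) = l2norm v := by
  simp [l2norm, sqNorm]

lemma sqNorm_smul' {k : ℕ} (c : ℝ) (v : Fin k → ℝ) : sqNorm (c • v) = c ^ 2 * sqNorm v := by
  simp [sqNorm, mul_pow, Finset.mul_sum]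

lemma l2norm_smul' {k : ℕ} (c : ℝ) (hc : 0 ≤ c) (v : Fin k → ℝ) :
    l2norm (c • v) = c * l2norm v := by
  rw [l2norm, sqNorm_smul', Real.sqrt_mul (sq_nonneg c), Real.sqrt_sq hc]; rfl

lemma sqNorm_add_smul {k : ℕ} (p q : Fin k → ℝ) (s : ℝ) :
    sqNorm (p + s • q) = sqNorm p + 2 * s * (p ⬝ᵥ q) + s ^ 2 * sqNorm q := by
  simp only [sqNorm, dotProduct, Finset.mul_sum, ← Finset.sum_add_distrib]
  refine Finset.sum_congr rfl fun i _ => ?_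
  simp only [Pi.add_apply, Pi.smul_apply, smul_eq_mul]; ring

lemma first_order {a b : ℝ} (h : ∀ s : ℝ, 0 < s → s ≤ 1 → 0 ≤ s * b + s ^ 2 * a) : 0 ≤ b := by
  by_contra hb
  push Not at hb
  have hp : 0 < |a| - b + 1 := by have := abs_nonneg a; linarith
  set s := -b / (|a| - b + 1) with hs
  have hs0 : 0 < s := div_pos (by linarith) hp
  have hs1 : s ≤ 1 := by
    rw [hs, div_le_one hp]; have := abs_nonneg a; linarith
  have h1 := h s hs0 hs1
  have h2 : 0 ≤ b + s * a := by
    have : 0 ≤ s * (b + s * a) := by nlinarith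
    exact nonneg_of_mul_nonneg_right this hs0
  have h3 : s * (|a| - b + 1) = -b := by rw [hs]; field_simp
  have h4 : s * a ≤ s * |a| := mul_le_mul_of_nonneg_left (le_abs_self a) hs0.le
  nlinarith

lemma Z2_bdd {n m : ℕ} (S : Matrix (Fin m) (Fin n) ℝ) (K : Set (Fin n → ℝ))
    (u : Fin n → ℝ) : BddAbove
    ((fun v => |u ⬝ᵥ (((1 / (m : ℝ)) • (Sᵀ * S) - 1).mulVec v)|) '' {v ∈ K | l2norm v = 1}) := by
  have hc : IsCompact (Metric.closedBall (0 : Fin n → ℝ) 1) := isCompact_closedBall _ _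
  refine (hc.bddAbove_image (f := fun v => |u ⬝ᵥ (((1 / (m : ℝ)) • (Sᵀ * S) - 1).mulVec v)|)
    (Continuous.continuousOn ?_)).mono (Set.image_mono ?_)
  · exact (Continuous.dotProduct continuous_const
      (Continuous.matrix_mulVec continuous_const continuous_id)).abs
  · rintro v ⟨-, hv⟩
    rw [mem_closedBall_zero_iff, pi_norm_le_iff_of_nonneg zero_le_one]
    intro i
    have h1 : sqNorm v = 1 := by rw [← l2norm_sq, hv, one_pow]
    have h2 : v i ^ 2 ≤ sqNorm v :=
      Finset.single_le_sum (f := fun i => v i ^ 2) (fun i _ => sq_nonneg _) (Finset.mem_univ i)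
    rw [Real.norm_eq_abs, ← sq_le_one_iff_abs_le_one]
    linarith

lemma Z1_bdd {n m : ℕ} (S : Matrix (Fin m) (Fin n) ℝ) (K : Set (Fin n → ℝ)) : BddBelow
    ((fun v => (1 / (m : ℝ)) * sqNorm (S.mulVec v)) '' {v ∈ K | l2norm v = 1}) := by
  refine ⟨0, ?_⟩
  rintro _ ⟨v, -, rfl⟩
  exact mul_nonneg (by positivity) (sqNorm_nonneg' _)

lemma contraction {n m : ℕ} (S : Matrix (Fin m) (Fin n) ℝ) (K : Set (Fin n → ℝ))
    (hK : ∀ v ∈ K, ∀ t : ℝ, 0 ≤ t → t • v ∈ K) (w h : Fin n → ℝ) (hw : w ∈ K)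
    (hh : h ≠ 0) (ρ : ℝ) (hρ : ρ ∈ Set.Ioo (0 : ℝ) (1 / 2))
    (hZ1 : 1 - ρ ≤ Z1 S K) (hZ2 : Z2 S K ((l2norm h)⁻¹ • h) ≤ ρ / 2)
    (hb : (1 / (m : ℝ)) * sqNorm (S.mulVec w)
      + h ⬝ᵥ (((1 / (m : ℝ)) • (Sᵀ * S) - 1).mulVec w) ≤ 0) :
    l2norm w ≤ ρ * l2norm h := by
  obtain ⟨hρ0, hρ1⟩ := hρ
  have hhn := l2norm_nonneg' h
  rcases (l2norm_nonneg' w).eq_or_lt with h0 | hpos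
  · rw [← h0]; positivity
  have hhpos : 0 < l2norm h := by
    refine hhn.lt_of_ne fun h0 => hh ?_
    have : sqNorm h = 0 := by rw [← l2norm_sq, ← h0]; norm_num
    rw [sqNorm_eq] at this
    exact dotProduct_self_eq_zero.mp this
  set v := (l2norm w)⁻¹ • w with hv
  have hvK : v ∈ {v ∈ K | l2norm v = 1} :=
    ⟨hK w hw _ (by positivity), by
      rw [hv, l2norm_smul' _ (by positivity)]; exact inv_mul_cancel₀ hpos.ne'⟩
  have h1 : 1 - ρ ≤ (1 / (m : ℝ)) * sqNorm (S.mulVec v) :=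
    hZ1.trans (csInf_le (Z1_bdd S K) ⟨v, hvK, rfl⟩)
  have h2 := (le_csSup (Z2_bdd S K ((l2norm h)⁻¹ • h)) ⟨v, hvK, rfl⟩).trans hZ2
  have h3 := (neg_le_abs _).trans h2
  rw [hv, mulVec_smul, sqNorm_smul'] at h1
  rw [hv, mulVec_smul, dotProduct_smul, smul_dotProduct, smul_eq_mul, smul_eq_mul] at h3
  set P := sqNorm (S.mulVec w)
  set Q := h ⬝ᵥ (((1 / (m : ℝ)) • (Sᵀ * S) - 1).mulVec w)
  set a := l2norm w
  set b := l2norm h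
  have e1 : (1 - ρ) * a ^ 2 ≤ 1 / (m : ℝ) * P := by
    have := mul_le_mul_of_nonneg_right h1 (sq_nonneg a)
    have e : 1 / (m : ℝ) * (a⁻¹ ^ 2 * P) * a ^ 2 = 1 / (m : ℝ) * P := by field_simp
    linarith
  have e2 : -Q ≤ ρ / 2 * (a * b) := by
    have := mul_le_mul_of_nonneg_right h3 (mul_pos hpos hhpos).le
    have e : -(a⁻¹ * (b⁻¹ * Q)) * (a * b) = -Q := by field_simp
    linarith
  have e3 : a * ((1 - ρ) * a) ≤ a * (ρ / 2 * b) := by nlinarith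
  have e4 := le_of_mul_le_mul_left e3 hpos
  nlinarith

lemma Z_sym {n m : ℕ} (S : Matrix (Fin m) (Fin n) ℝ) (c : ℝ) (h w : Fin n → ℝ) :
    h ⬝ᵥ ((c • (Sᵀ * S) - 1).mulVec w) = c * (S.mulVec h ⬝ᵥ S.mulVec w) - h ⬝ᵥ w := by
  rw [sub_mulVec, dotProduct_sub, one_mulVec, smul_mulVec, dotProduct_smul, smul_eq_mul,
    ← mulVec_mulVec, dotProduct_mulVec h Sᵀ, vecMul_transpose]

/-- geometric convergence of the iterative Hessian sketch
(Theorem 2, eq. (25)). Here `S t` is the sketch matrix S^{t+1} used to produce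
the iterate `x (t+1)`. -/
theorem ihs_geometric_convergence
    {n d m N : ℕ} (hn : 0 < n) (hm : 0 < m)
    (C : Set (Fin d → ℝ)) (hC : Convex ℝ C)
    (A : Matrix (Fin n) (Fin d) ℝ) (y : Fin n → ℝ)
    (S : ℕ → Matrix (Fin m) (Fin n) ℝ)
    (xLS : Fin d → ℝ) (hLSmem : xLS ∈ C)
    (hLSmin : ∀ x ∈ C,
      (1 / (2 * (n : ℝ))) * sqNorm (A.mulVec xLS - y)
        ≤ (1 / (2 * (n : ℝ))) * sqNorm (A.mulVec x - y))
    (x : ℕ → Fin d → ℝ) (hx0 : x 0 = 0)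
    (hstepmem : ∀ t < N, x (t + 1) ∈ C)
    (hstepmin : ∀ t < N, ∀ z ∈ C,
      (1 / (2 * (m : ℝ))) * sqNorm ((S t).mulVec (A.mulVec (x (t + 1) - x t)))
          - (Aᵀ.mulVec (y - A.mulVec (x t))) ⬝ᵥ x (t + 1)
        ≤ (1 / (2 * (m : ℝ))) * sqNorm ((S t).mulVec (A.mulVec (z - x t)))
          - (Aᵀ.mulVec (y - A.mulVec (x t))) ⬝ᵥ z)
    (ρ : ℝ) (hρ : ρ ∈ Set.Ioo (0 : ℝ) (1 / 2))
    (hAt : ∀ t < N, A.mulVec (xLS - x t) ≠ 0)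
    (hZ1 : ∀ t < N, 1 - ρ ≤ Z1 (S t) (Kcone A C xLS))
    (hZ2 : ∀ t < N,
      Z2 (S t) (Kcone A C xLS)
          ((l2norm (A.mulVec (xLS - x t)))⁻¹ • A.mulVec (xLS - x t)) ≤ ρ / 2) :
    predNorm A (x N - xLS) ≤ ρ ^ N * predNorm A xLS := by
  have hnR : (0 : ℝ) < n := by exact_mod_cast hn
  have hmR : (0 : ℝ) < m := by exact_mod_cast hm
  have hK : ∀ v ∈ Kcone A C xLS, ∀ t : ℝ, 0 ≤ t → t • v ∈ Kcone A C xLS := by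
    rintro v ⟨r, hr, z, hz, rfl⟩ t ht
    exact ⟨t * r, mul_nonneg ht hr, z, hz, by rw [smul_smul]⟩
  have hstep : ∀ t < N, l2norm (A.mulVec (x (t + 1) - xLS)) ≤
      ρ * l2norm (A.mulVec (x t - xLS)) := by
    intro t ht
    have hneg : l2norm (A.mulVec (x t - xLS)) = l2norm (A.mulVec (xLS - x t)) := by
      rw [← l2norm_neg', ← mulVec_neg, neg_sub]
    rw [hneg]
    refine contraction (S t) _ hK _ _ ⟨1, zero_le_one, x (t + 1), hstepmem t ht, by simp⟩
      (hAt t ht) ρ hρ (hZ1 t ht) (hZ2 t ht) ?_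
    set w := A.mulVec (x (t + 1) - xLS) with hw
    set h := A.mulVec (xLS - x t) with hh
    have o1 : 0 ≤ (A.mulVec xLS - y) ⬝ᵥ w := by
      refine first_order (a := sqNorm w / 2) fun s hs0 hs1 => ?_
      have := hLSmin (xLS + s • (x (t + 1) - xLS))
        (hC.add_smul_sub_mem hLSmem (hstepmem t ht) ⟨hs0.le, hs1⟩)
      have h1 := le_of_mul_le_mul_left this (by positivity)
      rw [mulVec_add, mulVec_smul, ← hw, add_sub_right_comm, sqNorm_add_smul] at h1
      linarith
    have o2 : 0 ≤ (1 / (m : ℝ)) * ((S t).mulVec (w + h) ⬝ᵥ (S t).mulVec (-w))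
        - (y - A.mulVec (x t)) ⬝ᵥ (-w) := by
      refine first_order (a := (1 / (2 * (m : ℝ))) * sqNorm ((S t).mulVec (-w)))
        fun s hs0 hs1 => ?_
      have := hstepmin t ht (x (t + 1) + s • (xLS - x (t + 1)))
        (hC.add_smul_sub_mem (hstepmem t ht) hLSmem ⟨hs0.le, hs1⟩)
      have ew : A.mulVec (xLS - x (t + 1)) = -w := by rw [hw, ← mulVec_neg, neg_sub]
      have eh : A.mulVec (x (t + 1) - x t) = w + h := by
        rw [hw, hh, ← mulVec_add]; congr 1; abel
      have hd : ∀ q p, (Aᵀ.mulVec q) ⬝ᵥ p = q ⬝ᵥ A.mulVec p := by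
        intro q p
        rw [mulVec_transpose, ← dotProduct_mulVec]
      rw [add_sub_right_comm, mulVec_add A, mulVec_smul A, ew, eh, mulVec_add (S t) (w + h),
        mulVec_smul (S t), sqNorm_add_smul, dotProduct_add, dotProduct_smul, smul_eq_mul,
        hd _ (xLS - x (t + 1)), ew] at this
      have e : 1 / (m : ℝ) = 2 * (1 / (2 * (m : ℝ))) := by field_simp
      rw [e]
      linarith
    have e2 : y - A.mulVec (x t) = h - (A.mulVec xLS - y) := by
      rw [hh, mulVec_sub]; abel
    rw [e2, mulVec_add, mulVec_neg, dotProduct_neg, dotProduct_neg, add_dotProduct,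
      sub_dotProduct] at o2
    rw [Z_sym, sqNorm_eq]
    linarith
  have key : ∀ t ≤ N, l2norm (A.mulVec (x t - xLS)) ≤ ρ ^ t * l2norm (A.mulVec xLS) := by
    intro t
    induction t with
    | zero => intro _; rw [hx0, zero_sub, mulVec_neg, l2norm_neg', pow_zero, one_mul]
    | succ t ih =>
      intro ht
      calc _ ≤ ρ * l2norm (A.mulVec (x t - xLS)) := hstep t ht
        _ ≤ ρ * (ρ ^ t * l2norm (A.mulVec xLS)) :=
          mul_le_mul_of_nonneg_left (ih (by omega)) hρ.1.le
        _ = _ := by ring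
  unfold predNorm
  rw [← mul_div_assoc]
  exact div_le_div_of_nonneg_right (key N le_rfl) (Real.sqrt_nonneg _)
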